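/- With D the Set Splitting MDP of the context, built from a finite set E = {e₁,…,eₙ} and a collection C = {C₁,…,C_m} of nonempty subsets of E: there exists a partition of E into two disjoint sets E₁ and E₂ such that no C_j is a subset of E₁ and no C_j is a subset of E₂, if and only if there exists a memoryless strategy α such that the probabilistic bisimilarity distance satisfies d_pb(s,t) = 1 in D(α). -/

import Mathlib

open Matrix

/-- A labelled Markov decision process: a partial probabilistic transition function
`phi : S × A ⇀ (S → ℝ)` and a labelling function. -/
structure MDP (S A L : Type) where
  phi : S → A → Option (S → ℝ)
  label : S → L

namespace MDP

variable {S A L : Type} [Fintype S] [Fintype A] [DecidableEq S]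

/-- The MDP data is well-formed: every state has an available action, and every
defined `phi s m` is a probability distribution on `S`. -/
def IsValid (D : MDP S A L) : Prop :=
  (∀ s, ∃ m, (D.phi s m).isSome) ∧
    ∀ s m d, D.phi s m = some d → (∀ t, 0 ≤ d t) ∧ (∑ t, d t) = 1

/-- Transition probabilities, with `0` for unavailable actions. -/
def trans (D : MDP S A L) (s : S) (m : A) : S → ℝ :=
  (D.phi s m).getD 0

/-- A memoryless strategy: for each state a probability distribution on the
available actions. -/
def IsStrategy (D : MDP S A L) (α : S → A → ℝ) : Prop :=
  ∀ s, (∀ m, 0 ≤ α s m) ∧ (∑ m, α s m) = 1 ∧ ∀ m, D.phi s m = none → α s m = 0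

/-- Transition probabilities of the induced labelled Markov chain `D(α)`. -/
def tau (D : MDP S A L) (α : S → A → ℝ) (s t : S) : ℝ :=
  ∑ m, α s m * D.trans s m t

/-- The matrix `M_α(a)`. -/
def Mmat [DecidableEq L] (D : MDP S A L) (α : S → A → ℝ) (a : L) : Matrix S S ℝ :=
  Matrix.of fun s t => if D.label s = a then D.tau α s t else 0

/-- The matrix `M_α(w)` for a word `w ∈ L*` (identity for the empty word). -/
def Mword [DecidableEq L] (D : MDP S A L) (α : S → A → ℝ) (w : List L) : Matrix S S ℝ :=
  (w.map (D.Mmat α)).prod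

/-- A memoryless deterministic (MD) strategy, viewed as a function `S → A`
choosing an available action in each state. -/
def IsMD (D : MDP S A L) (β : S → A) : Prop := ∀ s, (D.phi s (β s)).isSome

/-- The memoryless strategy corresponding to an MD strategy. -/
def mdStrat [DecidableEq A] (β : S → A) : S → A → ℝ :=
  fun s m => if m = β s then 1 else 0

end MDP

namespace MDP

variable {S A L : Type} [Fintype S] [Fintype A] [DecidableEq S]

/-- `ω` is a coupling of `μ` and `ν`: a joint distribution with marginals `μ`, `ν`. -/
def IsCoupling [Fintype S] (ω : S → S → ℝ) (μ ν : S → ℝ) : Prop :=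
  (∀ u v, 0 ≤ ω u v) ∧ (∀ u, (∑ v, ω u v) = μ u) ∧ ∀ v, (∑ u, ω u v) = ν v

open Classical in
/-- The map `Δ` on `[0,1]^{S×S}` whose least fixed point is the probabilistic
bisimilarity distance in the labelled Markov chain `D(α)`:
`Δ(d)(s,t) = 1` if `ℓ(s) ≠ ℓ(t)`, and otherwise the minimum over couplings `ω` of
`τ(s)` and `τ(t)` of `Σ_{u,v} ω(u,v)·d(u,v)`. -/
noncomputable def Delta (D : MDP S A L) (α : S → A → ℝ) (d : S → S → ℝ) :
    S → S → ℝ := fun s t =>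
  if D.label s ≠ D.label t then 1
  else sInf {x | ∃ ω, IsCoupling ω (D.tau α s) (D.tau α t) ∧
    x = ∑ u, ∑ v, ω u v * d u v}

/-- `d` is the least fixed point of `Δ` on `[0,1]^{S×S}`, i.e. the probabilistic
bisimilarity distance `d_pb` of the labelled Markov chain `D(α)`. -/
def IsBisimDist (D : MDP S A L) (α : S → A → ℝ) (d : S → S → ℝ) : Prop :=
  (∀ s t, d s t ∈ Set.Icc (0 : ℝ) 1) ∧ D.Delta α d = d ∧
    ∀ d', (∀ s t, d' s t ∈ Set.Icc (0 : ℝ) 1) → D.Delta α d' = d' →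
      ∀ s t, d s t ≤ d' s t

end MDP

/-- The Dirac distribution on a state. -/
def dirac {S : Type} [DecidableEq S] (x : S) : S → ℝ := fun y => if y = x then 1 else 0

/-- States of the Set Splitting MDP: `s, t, e₁,…,eₙ, C₁,…,C_m, C₁',…,C_m', u, v`. -/
inductive SplState (n m : ℕ) where
  | s | t | e (i : Fin n) | C (j : Fin m) | C' (j : Fin m) | u | v
deriving DecidableEq, Fintype

/-- Actions of the Set Splitting MDP: `Sum.inl i` (go to `e_i`, available in `C_j`
and `C_j'` when `e_i ∈ C_j`), `Sum.inr false`/`Sum.inr true` (the two actions of the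
`e_i`; `Sum.inr false` is also the unique action of `s, t, u, v`). -/
abbrev SplAct (n : ℕ) : Type := Fin n ⊕ Bool

/-- The transition function of the Set Splitting MDP built from the collection
`C₁,…,C_m` of subsets of `{e₁,…,eₙ}`. -/
noncomputable def splPhi (n m : ℕ) (C : Fin m → Finset (Fin n)) :
    SplState n m → SplAct n → Option (SplState n m → ℝ)
  | .s, .inr false =>
      some fun x => match x with | .C _ => 1 / (m : ℝ) | _ => 0
  | .t, .inr false =>
      some fun x => match x with | .C' _ => 1 / (m : ℝ) | _ => 0
  | .C j, .inl i => if i ∈ C j then some (dirac (.e i)) else none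
  | .C' j, .inl i => if i ∈ C j then some (dirac (.e i)) else none
  | .e _, .inr false => some (dirac .u)
  | .e _, .inr true => some (dirac .v)
  | .u, .inr false => some (dirac .u)
  | .v, .inr false => some (dirac .v)
  | _, _ => none

/-- The labelling function (labels from `Bool`, where `true` is the label `b`):
`v` carries label `b`, all other states label `a`. -/
def splLabel (n m : ℕ) : SplState n m → Bool
  | .v => true
  | _ => false

/-- The Set Splitting MDP. -/
noncomputable def splMDP (n m : ℕ) (C : Fin m → Finset (Fin n)) :
    MDP (SplState n m) (SplAct n) Bool :=
  ⟨splPhi n m C, splLabel n m⟩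

namespace MDP

variable {S A L : Type} [Fintype A]

/-- The transition probabilities induced by a memoryless deterministic strategy. -/
theorem tau_mdStrat [DecidableEq A] (D : MDP S A L) (β : S → A) (s t : S) :
    D.tau (mdStrat β) s t = D.trans s (β s) t := by
  simp [tau, mdStrat]

/-- A memoryless deterministic strategy is a strategy. -/
theorem IsMD.isStrategy [DecidableEq A] {D : MDP S A L} {β : S → A} (hβ : D.IsMD β) :
    D.IsStrategy (mdStrat β) := by
  refine fun s => ⟨fun m => ?_, by simp [mdStrat], fun m hm => ?_⟩
  · unfold mdStrat
    split_ifs <;> simp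
  · have hne : m ≠ β s := by
      rintro rfl
      simpa [hm] using hβ s
    simp [mdStrat, hne]

variable [Fintype S]

/-- Under a strategy of a well-formed MDP, the transition probabilities are nonnegative. -/
theorem tau_nonneg {D : MDP S A L} (hD : D.IsValid) {α : S → A → ℝ} (hα : D.IsStrategy α)
    (s t : S) : 0 ≤ D.tau α s t := by
  refine Finset.sum_nonneg fun m _ => mul_nonneg ((hα s).1 m) ?_
  cases h : D.phi s m with
  | none => simp [trans, h]
  | some p => simpa [trans, h] using (hD.2 s m p h).1 t

/-- Under a strategy of a well-formed MDP, the transition probabilities sum to one. -/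
theorem sum_tau {D : MDP S A L} (hD : D.IsValid) {α : S → A → ℝ} (hα : D.IsStrategy α)
    (s : S) : ∑ t, D.tau α s t = 1 := by
  simp only [tau]
  rw [Finset.sum_comm, ← (hα s).2.1]
  refine Finset.sum_congr rfl fun m _ => ?_
  rw [← Finset.mul_sum]
  cases h : D.phi s m with
  | none => simp [(hα s).2.2 m h]
  | some p => simp [trans, h, (hD.2 s m p h).2]

/-- The product of two distributions is a coupling. -/
theorem isCoupling_mul {μ ν : S → ℝ} (hμ : ∀ x, 0 ≤ μ x) (hν : ∀ x, 0 ≤ ν x)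
    (hμ1 : ∑ x, μ x = 1) (hν1 : ∑ x, ν x = 1) :
    IsCoupling (fun x y => μ x * ν y) μ ν := by
  refine ⟨fun x y => mul_nonneg (hμ x) (hν y), fun x => ?_, fun y => ?_⟩
  · rw [← Finset.mul_sum, hν1, mul_one]
  · rw [← Finset.sum_mul, hμ1, one_mul]

theorem IsCoupling.sum_eq_one {ω : S → S → ℝ} {μ ν : S → ℝ} (h : IsCoupling ω μ ν)
    (hμ1 : ∑ x, μ x = 1) : ∑ x, ∑ y, ω x y = 1 := by
  rw [← hμ1]
  exact Finset.sum_congr rfl fun x _ => h.2.1 x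

theorem IsCoupling.le_left {ω : S → S → ℝ} {μ ν : S → ℝ} (h : IsCoupling ω μ ν)
    (x y : S) : ω x y ≤ μ x := by
  rw [← h.2.1 x]
  exact Finset.single_le_sum (f := fun y => ω x y) (fun z _ => h.1 x z) (Finset.mem_univ y)

theorem IsCoupling.le_right {ω : S → S → ℝ} {μ ν : S → ℝ} (h : IsCoupling ω μ ν)
    (x y : S) : ω x y ≤ ν y := by
  rw [← h.2.2 y]
  exact Finset.single_le_sum (f := fun x => ω x y) (fun z _ => h.1 z y) (Finset.mem_univ x)

theorem IsCoupling.sum_mul_nonneg {ω : S → S → ℝ} {μ ν : S → ℝ} (h : IsCoupling ω μ ν)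
    {d : S → S → ℝ} (hd : ∀ x y, 0 ≤ d x y) : 0 ≤ ∑ x, ∑ y, ω x y * d x y :=
  Finset.sum_nonneg fun x _ => Finset.sum_nonneg fun y _ => mul_nonneg (h.1 x y) (hd x y)

/-- Every coupling gives an upper bound on `Δ` at equally labelled states. -/
theorem Delta_le {D : MDP S A L} {α : S → A → ℝ} {d : S → S → ℝ} (hd : ∀ x y, 0 ≤ d x y)
    {s t : S} (hl : D.label s = D.label t) {ω : S → S → ℝ}
    (hω : IsCoupling ω (D.tau α s) (D.tau α t)) :
    D.Delta α d s t ≤ ∑ x, ∑ y, ω x y * d x y := by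
  unfold Delta
  rw [if_neg (not_not.2 hl)]
  refine csInf_le ⟨0, ?_⟩ ⟨ω, hω, rfl⟩
  rintro _ ⟨ω', hω', rfl⟩
  exact hω'.sum_mul_nonneg hd

/-- A bound valid for every coupling is a lower bound on `Δ` at equally labelled states. -/
theorem le_Delta {D : MDP S A L} (hD : D.IsValid) {α : S → A → ℝ} (hα : D.IsStrategy α)
    {d : S → S → ℝ} {s t : S} (hl : D.label s = D.label t) {c : ℝ}
    (h : ∀ ω, IsCoupling ω (D.tau α s) (D.tau α t) → c ≤ ∑ x, ∑ y, ω x y * d x y) :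
    c ≤ D.Delta α d s t := by
  unfold Delta
  rw [if_neg (not_not.2 hl)]
  refine le_csInf ⟨_, _, isCoupling_mul (tau_nonneg hD hα s) (tau_nonneg hD hα t)
    (sum_tau hD hα s) (sum_tau hD hα t), rfl⟩ ?_
  rintro _ ⟨ω, hω, rfl⟩
  exact h ω hω

theorem Delta_of_label_ne {D : MDP S A L} {α : S → A → ℝ} {d : S → S → ℝ} {s t : S}
    (hl : D.label s ≠ D.label t) : D.Delta α d s t = 1 := by
  unfold Delta
  rw [if_pos hl]

theorem Delta_mono {D : MDP S A L} (hD : D.IsValid) {α : S → A → ℝ} (hα : D.IsStrategy α)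
    {d d' : S → S → ℝ} (hd : ∀ x y, 0 ≤ d x y) (h : ∀ x y, d x y ≤ d' x y) (s t : S) :
    D.Delta α d s t ≤ D.Delta α d' s t := by
  by_cases hl : D.label s = D.label t
  · refine le_Delta hD hα hl fun ω hω => (Delta_le hd hl hω).trans ?_
    exact Finset.sum_le_sum fun x _ => Finset.sum_le_sum fun y _ =>
      mul_le_mul_of_nonneg_left (h x y) (hω.1 x y)
  · rw [Delta_of_label_ne hl, Delta_of_label_ne hl]

theorem Delta_mem_Icc {D : MDP S A L} (hD : D.IsValid) {α : S → A → ℝ} (hα : D.IsStrategy α)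
    {d : S → S → ℝ} (hd : ∀ x y, d x y ∈ Set.Icc (0 : ℝ) 1) (s t : S) :
    D.Delta α d s t ∈ Set.Icc (0 : ℝ) 1 := by
  by_cases hl : D.label s = D.label t
  · have hω := isCoupling_mul (tau_nonneg hD hα s) (tau_nonneg hD hα t)
      (sum_tau hD hα s) (sum_tau hD hα t)
    refine ⟨le_Delta hD hα hl fun ω hω => hω.sum_mul_nonneg fun x y => (hd x y).1,
      (Delta_le (fun x y => (hd x y).1) hl hω).trans ?_⟩
    rw [← hω.sum_eq_one (sum_tau hD hα s)]
    exact Finset.sum_le_sum fun x _ => Finset.sum_le_sum fun y _ =>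
      mul_le_of_le_one_right (hω.1 x y) (hd x y).2
  · simp [Delta_of_label_ne hl]

/-- The probabilistic bisimilarity distance exists, and it lies below every
pre-fixed point of `Δ`. -/
theorem exists_isBisimDist {D : MDP S A L} (hD : D.IsValid) {α : S → A → ℝ}
    (hα : D.IsStrategy α) :
    ∃ d, D.IsBisimDist α d ∧ ∀ d', (∀ s t, d' s t ∈ Set.Icc (0 : ℝ) 1) →
      (∀ s t, D.Delta α d' s t ≤ d' s t) → ∀ s t, d s t ≤ d' s t := by
  let F : (S → S → unitInterval) →o (S → S → unitInterval) :=
    { toFun := fun d s t => ⟨D.Delta α (fun x y => d x y) s t,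
        Delta_mem_Icc hD hα (fun x y => (d x y).2) s t⟩
      monotone' := fun d d' h s t =>
        Delta_mono hD hα (fun x y => (d x y).2.1) (fun x y => h x y) s t }
  have hmin : ∀ d', (∀ s t, d' s t ∈ Set.Icc (0 : ℝ) 1) →
      (∀ s t, D.Delta α d' s t ≤ d' s t) → ∀ s t, (F.lfp s t : ℝ) ≤ d' s t :=
    fun d' hd' h s t =>
      F.lfp_le (a := fun x y => ⟨d' x y, hd' x y⟩) (fun x y => h x y) s t
  refine ⟨fun s t => F.lfp s t, ⟨fun s t => (F.lfp s t).2, ?_, fun d' hd' h => ?_⟩, hmin⟩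
  · funext s t
    exact congrArg Subtype.val (congrFun (congrFun F.map_lfp s) t)
  · exact hmin d' hd' fun s t => (congrFun (congrFun h s) t).le

theorem IsBisimDist.le_of_Delta_le {D : MDP S A L} (hD : D.IsValid) {α : S → A → ℝ}
    (hα : D.IsStrategy α) {d : S → S → ℝ} (hd : D.IsBisimDist α d) {d' : S → S → ℝ}
    (hd' : ∀ s t, d' s t ∈ Set.Icc (0 : ℝ) 1) (h : ∀ s t, D.Delta α d' s t ≤ d' s t)
    (s t : S) : d s t ≤ d' s t := by
  obtain ⟨d₀, hd₀, hmin⟩ := exists_isBisimDist hD hα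
  exact (hd.2.2 d₀ hd₀.1 hd₀.2.1 s t).trans (hmin d' hd' h s t)

/-- A state is at distance `0` from itself if its only successor is itself. -/
theorem IsBisimDist.self_eq_zero {D : MDP S A L} (hD : D.IsValid) {α : S → A → ℝ}
    (hα : D.IsStrategy α) {d : S → S → ℝ} (hd : D.IsBisimDist α d) {x : S}
    (hx : ∀ y, y ≠ x → D.tau α x y = 0) : d x x = 0 := by
  classical
  let d' : S → S → ℝ := fun s t => if s = x ∧ t = x then 0 else d s t
  have hd' : ∀ s t, d' s t ∈ Set.Icc (0 : ℝ) 1 := fun s t => by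
    by_cases h : s = x ∧ t = x <;> simp only [d', h, if_false]
    · simp
    · exact hd.1 s t
  have hle : ∀ s t, d' s t ≤ d s t := fun s t => by
    by_cases h : s = x ∧ t = x <;> simp only [d', h, if_false]
    · simpa using (hd.1 x x).1
    · exact le_rfl
  refine le_antisymm ?_ (hd.1 x x).1
  refine (hd.le_of_Delta_le hD hα hd' (fun s t => ?_) x x).trans (by simp [d'])
  by_cases h : s = x ∧ t = x
  · rw [h.1, h.2]
    refine (Delta_le (fun a b => (hd' a b).1) rfl (isCoupling_mul (tau_nonneg hD hα x)
      (tau_nonneg hD hα x) (sum_tau hD hα x) (sum_tau hD hα x))).trans ?_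
    have h0 : ∑ a, ∑ b, D.tau α x a * D.tau α x b * d' a b = 0 := by
      refine Finset.sum_eq_zero fun a _ => Finset.sum_eq_zero fun b _ => ?_
      by_cases ha : a = x
      · by_cases hb : b = x
        · simp [d', ha, hb]
        · simp [hx b hb]
      · simp [hx a ha]
    rw [h0]
    exact (hd' x x).1
  · calc D.Delta α d' s t ≤ D.Delta α d s t :=
          Delta_mono hD hα (fun a b => (hd' a b).1) hle s t
      _ = d s t := by rw [hd.2.1]
      _ = d' s t := by simp only [d', if_neg h]

/-- Two states are at distance `1` if all pairs of their successors are. -/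
theorem IsBisimDist.eq_one {D : MDP S A L} (hD : D.IsValid) {α : S → A → ℝ}
    (hα : D.IsStrategy α) {d : S → S → ℝ} (hd : D.IsBisimDist α d) {s t : S}
    (h : ∀ x y, D.tau α s x ≠ 0 → D.tau α t y ≠ 0 → d x y = 1) : d s t = 1 := by
  refine le_antisymm (hd.1 s t).2 ?_
  rw [← hd.2.1]
  by_cases hl : D.label s = D.label t
  · refine le_Delta hD hα hl fun ω hω => ?_
    rw [← hω.sum_eq_one (sum_tau hD hα s)]
    refine Finset.sum_le_sum fun x _ => Finset.sum_le_sum fun y _ => ?_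
    rcases (hω.1 x y).eq_or_lt with h0 | h0
    · simp [← h0]
    · rw [h x y (h0.trans_le (hω.le_left x y)).ne' (h0.trans_le (hω.le_right x y)).ne', mul_one]
  · rw [Delta_of_label_ne hl]

theorem IsBisimDist.eq_one_of_label_ne {D : MDP S A L} {α : S → A → ℝ} {d : S → S → ℝ}
    (hd : D.IsBisimDist α d) {s t : S} (hl : D.label s ≠ D.label t) : d s t = 1 := by
  rw [← hd.2.1, Delta_of_label_ne hl]

/-- If two equally labelled states are at distance `1`, then so is every pair of states
in the support of a coupling of their transition probabilities. -/
theorem IsBisimDist.eq_one_of_coupling {D : MDP S A L} (hD : D.IsValid) {α : S → A → ℝ}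
    (hα : D.IsStrategy α) {d : S → S → ℝ} (hd : D.IsBisimDist α d) {s t : S}
    (hl : D.label s = D.label t) (h1 : d s t = 1) {ω : S → S → ℝ}
    (hω : IsCoupling ω (D.tau α s) (D.tau α t)) {x y : S} (hxy : ω x y ≠ 0) : d x y = 1 := by
  by_contra hne
  have hlt : d x y < 1 := lt_of_le_of_ne (hd.1 x y).2 hne
  have hle : ∀ a b, ω a b * d a b ≤ ω a b := fun a b =>
    mul_le_of_le_one_right (hω.1 a b) (hd.1 a b).2
  have hsum : ∑ a, ∑ b, ω a b * d a b < ∑ a, ∑ b, ω a b := by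
    refine Finset.sum_lt_sum (fun a _ => Finset.sum_le_sum fun b _ => hle a b)
      ⟨x, Finset.mem_univ x, Finset.sum_lt_sum (fun b _ => hle x b) ⟨y, Finset.mem_univ y, ?_⟩⟩
    exact mul_lt_of_lt_one_right (lt_of_le_of_ne (hω.1 x y) hxy.symm) hlt
  have hge := Delta_le (fun a b => (hd.1 a b).1) hl hω
  rw [hd.2.1, h1] at hge
  rw [hω.sum_eq_one (sum_tau hD hα s)] at hsum
  exact hsum.not_ge hge

/-- If two equally labelled states are at distance `1`, then so are all pairs of their
successors. -/
theorem IsBisimDist.eq_one_of_tau_ne_zero {D : MDP S A L} (hD : D.IsValid) {α : S → A → ℝ}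
    (hα : D.IsStrategy α) {d : S → S → ℝ} (hd : D.IsBisimDist α d) {s t : S}
    (hl : D.label s = D.label t) (h1 : d s t = 1) {x y : S}
    (hx : D.tau α s x ≠ 0) (hy : D.tau α t y ≠ 0) : d x y = 1 :=
  hd.eq_one_of_coupling hD hα hl h1 (isCoupling_mul (tau_nonneg hD hα s)
    (tau_nonneg hD hα t) (sum_tau hD hα s) (sum_tau hD hα t)) (mul_ne_zero hx hy)

end MDP

theorem dirac_nonneg {S : Type} [DecidableEq S] (x y : S) : 0 ≤ dirac x y := by
  unfold dirac
  split_ifs <;> simp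

theorem sum_dirac {S : Type} [Fintype S] [DecidableEq S] (x : S) : ∑ y, dirac x y = 1 := by
  simp [dirac]

section SetSplitting

variable {n m : ℕ} {C : Fin m → Finset (Fin n)}

theorem SplState.C_injective : Function.Injective (SplState.C : Fin m → SplState n m) :=
  fun _ _ h => SplState.C.inj h

theorem SplState.C'_injective : Function.Injective (SplState.C' : Fin m → SplState n m) :=
  fun _ _ h => SplState.C'.inj h

theorem splMDP_isValid (hm : 1 ≤ m) (hC : ∀ j, (C j).Nonempty) : (splMDP n m C).IsValid := by
  have hm0 : (m : ℝ) ≠ 0 := by positivity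
  constructor
  · intro x
    cases x with
    | C j => exact ⟨.inl (hC j).choose, by simp [splMDP, splPhi, (hC j).choose_spec]⟩
    | C' j => exact ⟨.inl (hC j).choose, by simp [splMDP, splPhi, (hC j).choose_spec]⟩
    | _ => exact ⟨.inr false, by simp [splMDP, splPhi]⟩
  · intro x a p h
    have hdirac : ∀ y : SplState n m, (∀ z, 0 ≤ dirac y z) ∧ ∑ z, dirac y z = 1 :=
      fun y => ⟨dirac_nonneg y, sum_dirac y⟩
    rcases x with _ | _ | i | j | j | _ | _ <;> rcases a with k | (_ | _) <;>
      simp only [splMDP, splPhi, Option.some.injEq, reduceCtorEq, Option.ite_none_right_eq_some]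
        at h
    case s.inr.false =>
      subst h
      refine ⟨fun z => by cases z <;> simp, ?_⟩
      rw [← Fintype.sum_of_injective SplState.C SplState.C_injective (fun _ => 1 / (m : ℝ)) _
        (fun z hz => by cases z <;> simp at hz ⊢) fun _ => rfl]
      simp [hm0]
    case t.inr.false =>
      subst h
      refine ⟨fun z => by cases z <;> simp, ?_⟩
      rw [← Fintype.sum_of_injective SplState.C' SplState.C'_injective (fun _ => 1 / (m : ℝ)) _
        (fun z hz => by cases z <;> simp at hz ⊢) fun _ => rfl]
      simp [hm0]
    case C.inl => exact h.2 ▸ hdirac _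
    case C'.inl => exact h.2 ▸ hdirac _
    all_goals exact h ▸ hdirac _

theorem splMDP_tau_s {α : SplState n m → SplAct n → ℝ} (hα : (splMDP n m C).IsStrategy α)
    (x : SplState n m) :
    (splMDP n m C).tau α .s x = ∑ j, 1 / (m : ℝ) * dirac (.C j) x := by
  have h := (hα .s).2.1
  simp only [Fintype.sum_sum_type, Fintype.sum_bool,
    fun i => (hα .s).2.2 (.inl i) rfl, (hα .s).2.2 (.inr true) rfl] at h
  simp only [Finset.sum_const_zero, zero_add] at h
  cases x <;> simp [MDP.tau, MDP.trans, splMDP, splPhi, h, dirac]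

theorem splMDP_tau_t {α : SplState n m → SplAct n → ℝ} (hα : (splMDP n m C).IsStrategy α)
    (x : SplState n m) :
    (splMDP n m C).tau α .t x = ∑ j, 1 / (m : ℝ) * dirac (.C' j) x := by
  have h := (hα .t).2.1
  simp only [Fintype.sum_sum_type, Fintype.sum_bool,
    fun i => (hα .t).2.2 (.inl i) rfl, (hα .t).2.2 (.inr true) rfl] at h
  simp only [Finset.sum_const_zero, zero_add] at h
  cases x <;> simp [MDP.tau, MDP.trans, splMDP, splPhi, h, dirac]

theorem splMDP_tau_e (α : SplState n m → SplAct n → ℝ) (i : Fin n) (x : SplState n m) :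
    (splMDP n m C).tau α (.e i) x =
      α (.e i) (.inr true) * dirac .v x + α (.e i) (.inr false) * dirac .u x := by
  simp [MDP.tau, MDP.trans, splMDP, splPhi]

/-- The coupling of the successor distributions of `s` and `t` that pairs each `C_j` with
its copy `C_j'`. -/
theorem splMDP_isCoupling_diag {α : SplState n m → SplAct n → ℝ}
    (hα : (splMDP n m C).IsStrategy α) :
    MDP.IsCoupling (fun x y => ∑ j : Fin m, 1 / (m : ℝ) * dirac (.C j) x * dirac (.C' j) y)
      ((splMDP n m C).tau α .s) ((splMDP n m C).tau α .t) := by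
  refine ⟨fun x y => Finset.sum_nonneg fun j _ => ?_, fun x => ?_, fun y => ?_⟩
  · have := dirac_nonneg (SplState.C (n := n) j) x
    have := dirac_nonneg (SplState.C' (n := n) j) y
    positivity
  · rw [splMDP_tau_s hα, Finset.sum_comm]
    refine Finset.sum_congr rfl fun j _ => ?_
    rw [← Finset.mul_sum, sum_dirac, mul_one]
  · rw [splMDP_tau_t hα, Finset.sum_comm]
    refine Finset.sum_congr rfl fun j _ => ?_
    rw [← Finset.sum_mul, ← Finset.mul_sum, sum_dirac, mul_one]

/-- The state `C_j` has a successor `e_i` with `e_i ∈ C_j`. -/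
theorem splMDP_exists_tau_C_ne_zero {α : SplState n m → SplAct n → ℝ}
    (hα : (splMDP n m C).IsStrategy α) (j : Fin m) :
    ∃ i ∈ C j, (splMDP n m C).tau α (.C j) (.e i) ≠ 0 := by
  have hsum : ∑ a, α (.C j) a ≠ 0 := by simp [(hα (.C j)).2.1]
  obtain ⟨a, -, ha⟩ := Finset.exists_ne_zero_of_sum_ne_zero hsum
  have hphi : (splMDP n m C).phi (.C j) a ≠ none := fun h => ha ((hα (.C j)).2.2 a h)
  rcases a with i | b
  · have hi : i ∈ C j := by simpa [splMDP, splPhi] using hphi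
    refine ⟨i, hi, ?_⟩
    suffices (splMDP n m C).tau α (.C j) (.e i) = α (.C j) (.inl i) by rwa [this]
    rw [MDP.tau, Finset.sum_eq_single (.inl i)]
    · simp [MDP.trans, splMDP, splPhi, hi, dirac]
    · rintro (k | b) - hk
      · have hik : i ≠ k := fun h => hk (h ▸ rfl)
        by_cases hkC : k ∈ C j <;> simp [MDP.trans, splMDP, splPhi, hkC, dirac, hik]
      · simp [MDP.trans, splMDP, splPhi]
    · simp
  · simp [splMDP, splPhi] at hphi

/-- The state `C_j'` has a successor `e_i` with `e_i ∈ C_j`. -/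
theorem splMDP_exists_tau_C'_ne_zero {α : SplState n m → SplAct n → ℝ}
    (hα : (splMDP n m C).IsStrategy α) (j : Fin m) :
    ∃ i ∈ C j, (splMDP n m C).tau α (.C' j) (.e i) ≠ 0 := by
  have hsum : ∑ a, α (.C' j) a ≠ 0 := by simp [(hα (.C' j)).2.1]
  obtain ⟨a, -, ha⟩ := Finset.exists_ne_zero_of_sum_ne_zero hsum
  have hphi : (splMDP n m C).phi (.C' j) a ≠ none := fun h => ha ((hα (.C' j)).2.2 a h)
  rcases a with i | b
  · have hi : i ∈ C j := by simpa [splMDP, splPhi] using hphi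
    refine ⟨i, hi, ?_⟩
    suffices (splMDP n m C).tau α (.C' j) (.e i) = α (.C' j) (.inl i) by rwa [this]
    rw [MDP.tau, Finset.sum_eq_single (.inl i)]
    · simp [MDP.trans, splMDP, splPhi, hi, dirac]
    · rintro (k | b) - hk
      · have hik : i ≠ k := fun h => hk (h ▸ rfl)
        by_cases hkC : k ∈ C j <;> simp [MDP.trans, splMDP, splPhi, hkC, dirac, hik]
      · simp [MDP.trans, splMDP, splPhi]
    · simp
  · simp [splMDP, splPhi] at hphi

/-- A splitting of the collection yields a strategy under which `s` and `t` are at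
distance `1`. -/
theorem exists_strategy_of_splitting (hm : 1 ≤ m) (hC : ∀ j, (C j).Nonempty)
    {E₁ : Finset (Fin n)} (hE : ∀ j, ¬ C j ⊆ E₁ ∧ ¬ C j ⊆ E₁ᶜ) :
    ∃ α, (splMDP n m C).IsStrategy α ∧
      ∃ d, (splMDP n m C).IsBisimDist α d ∧ d SplState.s SplState.t = 1 := by
  have hD : (splMDP n m C).IsValid := splMDP_isValid hm hC
  choose f hfC hf using fun j => Finset.not_subset.1 (hE j).2
  choose g hgC hg using fun j => Finset.not_subset.1 (hE j).1
  simp only [Finset.mem_compl, not_not] at hf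
  let β : SplState n m → SplAct n
    | .e i => .inr (decide (i ∉ E₁))
    | .C j => .inl (f j)
    | .C' j => .inl (g j)
    | _ => .inr false
  have hβ : (splMDP n m C).IsMD β := by
    intro x
    cases x with
    | e i => by_cases hi : i ∈ E₁ <;> simp [β, splMDP, splPhi, hi]
    | C j => simp [β, splMDP, splPhi, hfC]
    | C' j => simp [β, splMDP, splPhi, hgC]
    | _ => simp [β, splMDP, splPhi]
  have hα := hβ.isStrategy
  obtain ⟨d, hd, -⟩ := MDP.exists_isBisimDist hD hα
  have hE1 : ∀ i ∈ E₁, ∀ k ∉ E₁, d (.e i) (.e k) = 1 := fun i hi k hk =>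
    hd.eq_one hD hα fun x y hx hy => by
      have hx' : x = .u := by
        simpa [MDP.tau_mdStrat, MDP.trans, splMDP, splPhi, β, hi, dirac] using hx
      have hy' : y = .v := by
        simpa [MDP.tau_mdStrat, MDP.trans, splMDP, splPhi, β, hk, dirac] using hy
      subst hx' hy'
      exact hd.eq_one_of_label_ne (by simp [splMDP, splLabel])
  have hCC : ∀ j k, d (.C j) (.C' k) = 1 := fun j k =>
    hd.eq_one hD hα fun x y hx hy => by
      have hx' : x = .e (f j) := by
        simpa [MDP.tau_mdStrat, MDP.trans, splMDP, splPhi, β, hfC, dirac] using hx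
      have hy' : y = .e (g k) := by
        simpa [MDP.tau_mdStrat, MDP.trans, splMDP, splPhi, β, hgC, dirac] using hy
      subst hx' hy'
      exact hE1 _ (hf j) _ (hg k)
  refine ⟨_, hα, d, hd, hd.eq_one hD hα fun x y hx hy => ?_⟩
  rw [splMDP_tau_s hα] at hx
  rw [splMDP_tau_t hα] at hy
  obtain ⟨j, -, hj⟩ := Finset.exists_ne_zero_of_sum_ne_zero hx
  obtain ⟨k, -, hk⟩ := Finset.exists_ne_zero_of_sum_ne_zero hy
  have hx' : x = .C j := by
    by_contra h
    simp [dirac, h] at hj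
  have hy' : y = .C' k := by
    by_contra h
    simp [dirac, h] at hk
  subst hx' hy'
  exact hCC j k

/-- A strategy under which `s` and `t` are at distance `1` yields a splitting. -/
theorem exists_splitting_of_strategy (hm : 1 ≤ m) (hC : ∀ j, (C j).Nonempty)
    {α : SplState n m → SplAct n → ℝ} (hα : (splMDP n m C).IsStrategy α)
    {d : SplState n m → SplState n m → ℝ} (hd : (splMDP n m C).IsBisimDist α d)
    (h1 : d .s .t = 1) :
    ∃ E₁ : Finset (Fin n), ∀ j, ¬ C j ⊆ E₁ ∧ ¬ C j ⊆ E₁ᶜ := by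
  have hD : (splMDP n m C).IsValid := splMDP_isValid hm hC
  have hm0 : (m : ℝ) ≠ 0 := by positivity
  have hu : d .u .u = 0 := hd.self_eq_zero hD hα fun y hy => by
    simp [MDP.tau, MDP.trans, splMDP, splPhi, dirac, hy]
  have hv : d .v .v = 0 := hd.self_eq_zero hD hα fun y hy => by
    simp [MDP.tau, MDP.trans, splMDP, splPhi, dirac, hy]
  have he : ∀ i k, d (.e i) (.e k) = 1 →
      (α (.e i) (.inr false) ≠ 0 ↔ α (.e k) (.inr false) = 0) := by
    intro i k hik
    have hsucc : ∀ x y, (splMDP n m C).tau α (.e i) x ≠ 0 →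
        (splMDP n m C).tau α (.e k) y ≠ 0 → d x y = 1 :=
      fun _ _ => hd.eq_one_of_tau_ne_zero hD hα (by rfl) hik
    have huu := hsucc .u .u
    have hvv := hsucc .v .v
    have hsum : ∀ i, α (.e i) (.inr true) + α (.e i) (.inr false) = 1 := fun i => by
      have h := (hα (.e i)).2.1
      simpa [Fintype.sum_sum_type, fun k => (hα (.e i)).2.2 (.inl k) rfl] using h
    simp only [splMDP_tau_e, dirac, hu, hv] at huu hvv
    simp at huu hvv
    have := hsum i
    have := hsum k
    refine ⟨huu, fun hk hi => ?_⟩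
    simp_all
  refine ⟨Finset.univ.filter fun i => α (.e i) (.inr false) ≠ 0, fun j => ?_⟩
  have hj : d (.C j) (.C' j) = 1 := by
    refine hd.eq_one_of_coupling hD hα (by rfl) h1 (splMDP_isCoupling_diag hα) ?_
    simp [dirac, hm0]
  obtain ⟨i, hiC, hi⟩ := splMDP_exists_tau_C_ne_zero hα j
  obtain ⟨k, hkC, hk⟩ := splMDP_exists_tau_C'_ne_zero hα j
  have hik := he i k (hd.eq_one_of_tau_ne_zero hD hα (by rfl) hj hi hk)
  constructor <;> intro hsub <;> have h₁ := hsub hiC <;> have h₂ := hsub hkC <;>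
    simp at h₁ h₂ <;> tauto

end SetSplitting

/-- the set `{e₁,…,eₙ}` can be partitioned into `E₁` and its
complement such that no `C_j` is contained in `E₁` or in its complement, iff there
is a memoryless strategy `α` such that the probabilistic bisimilarity distance
satisfies `d_pb(s,t) = 1` in `D(α)`. -/
theorem setSplitting_iff_exists_strategy_dpb_eq_one
    (n m : ℕ) (hn : 1 ≤ n) (hm : 1 ≤ m)
    (C : Fin m → Finset (Fin n)) (hC : ∀ j, (C j).Nonempty) :
    (∃ E₁ : Finset (Fin n), ∀ j, ¬ C j ⊆ E₁ ∧ ¬ C j ⊆ E₁ᶜ) ↔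
      ∃ α, (splMDP n m C).IsStrategy α ∧
        ∃ d, (splMDP n m C).IsBisimDist α d ∧ d SplState.s SplState.t = 1 :=
  ⟨fun ⟨_, hE⟩ => exists_strategy_of_splitting hm hC hE,
    fun ⟨_, hα, _, hd, h1⟩ => exists_splitting_of_strategy hm hC hα hd h1⟩
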